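/- Let n ≥ 1, for each i ∈ {1,…,n} let ι_i be a type of cardinality at most 𝔠, and let M be a compact Hausdorff space such that C(M;ℂ) is isometrically isomorphic as a complex Banach algebra to L^∞(𝕋). Let X be the topological sum M ⊕ 𝕋^{ι_1} ⊕ ⋯ ⊕ 𝕋^{ι_n} ⊕ OnePoint ℕ, where 𝕋^{ι_i} = (ι_i → 𝕋) carries the product topology. Then C(X;ℂ) admits an isometric shift. -/

import Mathlib

open Topology

/-- `T` is an isometric shift: an isometry whose range has codimension 1 and with
`⋂_{n≥1} Tⁿ(E) = {0}`. -/
def IsIsometricShift {𝕜 E : Type*} [RCLike 𝕜] [NormedAddCommGroup E] [NormedSpace 𝕜 E]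
    (T : E →L[𝕜] E) : Prop :=
  (∀ f, ‖T f‖ = ‖f‖) ∧
    Module.rank 𝕜 (E ⧸ LinearMap.range (T : E →ₗ[𝕜] E)) = 1 ∧
    (⋂ n : ℕ, Set.range ((⇑T)^[n + 1])) = {0}

open MeasureTheory in
instance : Fact (0 < 2 * Real.pi) := ⟨by positivity⟩

open MeasureTheory in
/-- `C(M, ℂ)` is isometrically isomorphic, as a complex Banach algebra, to `L^∞(𝕋)`
(realized as `Lp ℂ ∞` of the circle `ℝ/2πℤ` with Lebesgue/Haar measure): there is a
complex-linear isometric equivalence which is moreover multiplicative (hence a Banach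
algebra isomorphism). -/
def IsCMIsoLinftyCircle (M : Type*) [TopologicalSpace M] [CompactSpace M] : Prop :=
  ∃ e : C(M, ℂ) ≃ₗᵢ[ℂ] Lp ℂ ⊤ (volume : Measure (AddCircle (2 * Real.pi))),
    ∀ f g : C(M, ℂ),
      ((e (f * g) : AddCircle (2 * Real.pi) →ₘ[volume] ℂ)) = ↑(e f) * ↑(e g)

open Filter

section ConvergentSequences

open OnePoint

/-- The convergent sequence obtained from `s` by inserting `c` in front. -/
noncomputable def prependSeq (c : ℂ) (s : C(OnePoint ℕ, ℂ)) : C(OnePoint ℕ, ℂ) :=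
  continuousMapMkNat (fun n => Nat.casesOn n c fun k => s (k : ℕ)) (s ∞) <| by
    rw [← tendsto_add_atTop_iff_nat 1]
    exact (continuous_iff_from_nat s).1 s.continuous

@[simp] theorem prependSeq_zero (c : ℂ) (s : C(OnePoint ℕ, ℂ)) :
    prependSeq c s ((0 : ℕ) : OnePoint ℕ) = c := rfl

@[simp] theorem prependSeq_succ (c : ℂ) (s : C(OnePoint ℕ, ℂ)) (n : ℕ) :
    prependSeq c s ((n + 1 : ℕ) : OnePoint ℕ) = s n := rfl

@[simp] theorem prependSeq_infty (c : ℂ) (s : C(OnePoint ℕ, ℂ)) :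
    prependSeq c s ∞ = s ∞ := rfl

theorem ContinuousMap.ext_onePoint_nat {s t : C(OnePoint ℕ, ℂ)} (h : ∀ n : ℕ, s n = t n) :
    s = t := by
  ext x
  refine congr_fun (OnePoint.denseRange_coe.equalizer s.continuous t.continuous ?_) x
  ext n
  exact h n

theorem prependSeq_add (c d : ℂ) (s t : C(OnePoint ℕ, ℂ)) :
    prependSeq (c + d) (s + t) = prependSeq c s + prependSeq d t :=
  ContinuousMap.ext_onePoint_nat fun n => by cases n <;> simp

theorem prependSeq_smul (a c : ℂ) (s : C(OnePoint ℕ, ℂ)) :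
    prependSeq (a * c) (a • s) = a • prependSeq c s :=
  ContinuousMap.ext_onePoint_nat fun n => by cases n <;> simp

theorem norm_prependSeq (c : ℂ) (s : C(OnePoint ℕ, ℂ)) :
    ‖prependSeq c s‖ = max ‖c‖ ‖s‖ := by
  refine le_antisymm ((ContinuousMap.norm_le _ (by positivity)).2 fun x => ?_)
    (max_le ((prependSeq c s).norm_coe_le_norm (0 : ℕ))
      ((ContinuousMap.norm_le _ (norm_nonneg _)).2 fun x => ?_))
  · induction x using OnePoint.rec with
    | infty => exact (s.norm_coe_le_norm ∞).trans (le_max_right _ _)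
    | coe n =>
      cases n with
      | zero => exact le_max_left _ _
      | succ n => exact (s.norm_coe_le_norm n).trans (le_max_right _ _)
  · induction x using OnePoint.rec with
    | infty => exact (prependSeq c s).norm_coe_le_norm ∞
    | coe n => exact (prependSeq c s).norm_coe_le_norm (n + 1 : ℕ)

theorem exists_eq_prependSeq (s : C(OnePoint ℕ, ℂ)) :
    ∃ t, s = prependSeq (s (0 : ℕ)) t :=
  ⟨continuousMapMkNat (fun n => s (n + 1 : ℕ)) (s ∞)
    (((continuous_iff_from_nat s).1 s.continuous).comp (tendsto_add_atTop_nat 1)),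
    ContinuousMap.ext_onePoint_nat fun n => by cases n <;> rfl⟩

section AbstractShift

variable {A : Type*} [NormedAddCommGroup A] [NormedSpace ℂ A]

/-- The isometry `(g, s) ↦ (S g, (μ g, s 0, s 1, …))`. -/
noncomputable def prependShift (S : A ≃ₗᵢ[ℂ] A) (μ : A →L[ℂ] ℂ) (hμ : ‖μ‖ ≤ 1) :
    A × C(OnePoint ℕ, ℂ) →ₗᵢ[ℂ] A × C(OnePoint ℕ, ℂ) where
  toFun p := (S p.1, prependSeq (μ p.1) p.2)
  map_add' p q := by simp [prependSeq_add]
  map_smul' a p := by simp [← prependSeq_smul]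
  norm_map' p := by
    have h : ‖μ p.1‖ ≤ ‖p.1‖ := (μ.le_of_opNorm_le hμ _).trans_eq (one_mul _)
    simp only [LinearMap.coe_mk, AddHom.coe_mk, Prod.norm_def, S.norm_map, norm_prependSeq]
    rw [← max_assoc, max_eq_left h]

theorem prependShift_apply (S : A ≃ₗᵢ[ℂ] A) (μ : A →L[ℂ] ℂ) (hμ : ‖μ‖ ≤ 1)
    (p : A × C(OnePoint ℕ, ℂ)) :
    prependShift S μ hμ p = (S p.1, prependSeq (μ p.1) p.2) := rfl

theorem prependShift_iterate_fst (S : A ≃ₗᵢ[ℂ] A) (μ : A →L[ℂ] ℂ) (hμ : ‖μ‖ ≤ 1) (n : ℕ)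
    (p : A × C(OnePoint ℕ, ℂ)) : ((prependShift S μ hμ)^[n] p).1 = S^[n] p.1 := by
  induction n generalizing p with
  | zero => rfl
  | succ n ih => rw [Function.iterate_succ_apply, ih, Function.iterate_succ_apply]; rfl

theorem prependShift_iterate_snd (S : A ≃ₗᵢ[ℂ] A) (μ : A →L[ℂ] ℂ) (hμ : ‖μ‖ ≤ 1) (n : ℕ)
    (p : A × C(OnePoint ℕ, ℂ)) : ((prependShift S μ hμ)^[n + 1] p).2 n = μ p.1 := by
  induction n with
  | zero => rfl
  | succ n ih => rw [Function.iterate_succ_apply', prependShift_apply, prependSeq_succ, ih]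

/-- If the only `g` for which `μ (R ^ (n + 1) g)` converges is `g = 0`, then `A × c` admits an
isometric shift, where `c` is the space of convergent sequences. -/
theorem exists_isIsometricShift_prod (R : A ≃ₗᵢ[ℂ] A) (μ : A →L[ℂ] ℂ)
    (h : ∀ g L, Tendsto (fun n : ℕ => μ (R^[n + 1] g)) atTop (𝓝 L) → g = 0) :
    ∃ T : A × C(OnePoint ℕ, ℂ) →L[ℂ] A × C(OnePoint ℕ, ℂ), IsIsometricShift T := by
  wlog hμ : ‖μ‖ ≤ 1 generalizing μ
  · have hpos : 0 < ‖μ‖ := one_pos.trans (not_le.1 hμ)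
    refine this (((‖μ‖⁻¹ : ℝ) : ℂ) • μ) (fun g L hL => h g (‖μ‖ * L) ?_) ?_
    · refine (hL.const_mul (‖μ‖ : ℂ)).congr fun n => ?_
      simp [hpos.ne']
    · rw [norm_smul, Complex.norm_real, norm_inv, norm_norm, inv_mul_cancel₀ hpos.ne']
  set T := prependShift R.symm μ hμ with hT
  refine ⟨T.toContinuousLinearMap, T.norm_map, ?_, ?_⟩
  · let ℓ : A × C(OnePoint ℕ, ℂ) →ₗ[ℂ] ℂ :=
      { toFun := fun p => p.2 (0 : ℕ) - μ (R p.1)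
        map_add' := fun p q => by simp; ring
        map_smul' := fun a p => by simp; ring }
    have hker : LinearMap.range (T.toContinuousLinearMap :
        A × C(OnePoint ℕ, ℂ) →ₗ[ℂ] A × C(OnePoint ℕ, ℂ)) =
        LinearMap.ker ℓ := by
      ext ⟨g, s⟩
      simp only [LinearMap.mem_range, LinearMap.mem_ker]
      constructor
      · rintro ⟨p, hp⟩
        change (R.symm p.1, prependSeq (μ p.1) p.2) = (g, s) at hp
        obtain ⟨rfl, rfl⟩ := Prod.mk.inj hp
        change prependSeq (μ p.1) p.2 (0 : ℕ) - μ (R (R.symm p.1)) = 0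
        simp
      · intro hs
        change s (0 : ℕ) - μ (R g) = 0 at hs
        obtain ⟨t, ht⟩ := exists_eq_prependSeq s
        refine ⟨(R g, t), ?_⟩
        change (R.symm (R g), prependSeq (μ (R g)) t) = (g, s)
        rw [R.symm_apply_apply, ← sub_eq_zero.1 hs, ← ht]
    have hsurj : Function.Surjective ℓ := fun c =>
      ⟨(0, prependSeq c 0), by change prependSeq c 0 (0 : ℕ) - μ (R 0) = c; simp⟩
    rw [hker, Module.rank_eq_one_iff_finrank_eq_one,
      (ℓ.quotKerEquivOfSurjective hsurj).finrank_eq, Module.finrank_self]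
  · refine Set.eq_singleton_iff_unique_mem.2
      ⟨Set.mem_iInter.2 fun n => ⟨0, iterate_map_zero _ _⟩, fun p hp => ?_⟩
    have key : ∀ n : ℕ, p.2 n = μ (R^[n + 1] p.1) := by
      intro n
      obtain ⟨q, rfl⟩ := Set.mem_iInter.1 hp n
      have hinv : Function.LeftInverse R R.symm := R.apply_symm_apply
      change (T^[n + 1] q).2 n = μ (R^[n + 1] (T^[n + 1] q).1)
      rw [prependShift_iterate_snd, prependShift_iterate_fst, hinv.iterate (n + 1)]
    have h1 : p.1 = 0 := h p.1 (p.2 ∞) <|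
      ((continuous_iff_from_nat p.2).1 p.2.continuous).congr key
    refine Prod.ext h1 (ContinuousMap.ext_onePoint_nat fun n => ?_)
    rw [key, h1, iterate_map_zero, map_zero]
    rfl

end AbstractShift

end ConvergentSequences

theorem IsIsometricShift.exists_of_linearIsometryEquiv.{u} {E F : Type u}
    [NormedAddCommGroup E] [NormedSpace ℂ E] [NormedAddCommGroup F] [NormedSpace ℂ F]
    (e : E ≃ₗᵢ[ℂ] F) (h : ∃ T : F →L[ℂ] F, IsIsometricShift T) :
    ∃ T : E →L[ℂ] E, IsIsometricShift T := by
  obtain ⟨T, hnorm, hrank, hinter⟩ := h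
  let S : E →L[ℂ] E :=
    (e.symm.toContinuousLinearEquiv : F →L[ℂ] E) ∘L T ∘L (e.toContinuousLinearEquiv : E →L[ℂ] F)
  have hsemi : Function.Semiconj e S T := fun x => e.apply_symm_apply _
  refine ⟨S, fun f => ?_, ?_, ?_⟩
  · rw [← e.norm_map, hsemi, hnorm, e.norm_map]
  · rw [← hrank]
    refine (Submodule.Quotient.equiv _ _ e.toLinearEquiv ?_).rank_eq
    ext y
    constructor
    · rintro ⟨_, ⟨x, rfl⟩, rfl⟩
      exact ⟨e x, (hsemi x).symm⟩
    · rintro ⟨x, rfl⟩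
      exact ⟨S (e.symm x), ⟨_, rfl⟩, (hsemi _).trans (congrArg T (e.apply_symm_apply x))⟩
  · refine Set.eq_singleton_iff_unique_mem.2
      ⟨Set.mem_iInter.2 fun n => ⟨0, iterate_map_zero _ _⟩, fun f hf => ?_⟩
    have : e f ∈ ⋂ n : ℕ, Set.range ((⇑T)^[n + 1]) := Set.mem_iInter.2 fun n => by
      obtain ⟨x, rfl⟩ := Set.mem_iInter.1 hf n
      exact ⟨e x, ((hsemi.iterate_right (n + 1)) x).symm⟩
    rw [hinter] at this
    exact e.map_eq_zero_iff.1 this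

/-- Continuous functions on a disjoint sum are pairs of continuous functions. -/
noncomputable def ContinuousMap.sumLinearIsometryEquiv (X Y : Type*) [TopologicalSpace X]
    [TopologicalSpace Y] [CompactSpace X] [CompactSpace Y] :
    C(X ⊕ Y, ℂ) ≃ₗᵢ[ℂ] C(X, ℂ) × C(Y, ℂ) where
  toFun f := (f.comp ⟨Sum.inl, continuous_inl⟩, f.comp ⟨Sum.inr, continuous_inr⟩)
  invFun p := ⟨Sum.elim p.1 p.2, p.1.continuous.sumElim p.2.continuous⟩
  left_inv f := by ext (x | x) <;> rfl
  right_inv p := rfl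
  map_add' f g := rfl
  map_smul' a f := rfl
  norm_map' f := by
    refine le_antisymm (max_le ?_ ?_) ((ContinuousMap.norm_le _ (norm_nonneg _)).2 ?_)
    · exact (ContinuousMap.norm_le _ (norm_nonneg _)).2 fun x => f.norm_coe_le_norm _
    · exact (ContinuousMap.norm_le _ (norm_nonneg _)).2 fun x => f.norm_coe_le_norm _
    · rintro (x | x)
      · exact (ContinuousMap.norm_coe_le_norm (f.comp ⟨Sum.inl, continuous_inl⟩) x).trans
          (le_max_left _ _)
      · exact (ContinuousMap.norm_coe_le_norm (f.comp ⟨Sum.inr, continuous_inr⟩) x).trans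
          (le_max_right _ _)

/-- The product of two linear isometric equivalences. -/
def LinearIsometryEquiv.prodMap {E E' F F' : Type*} [NormedAddCommGroup E] [NormedSpace ℂ E]
    [NormedAddCommGroup E'] [NormedSpace ℂ E'] [NormedAddCommGroup F] [NormedSpace ℂ F]
    [NormedAddCommGroup F'] [NormedSpace ℂ F'] (e : E ≃ₗᵢ[ℂ] E') (f : F ≃ₗᵢ[ℂ] F') :
    E × F ≃ₗᵢ[ℂ] E' × F' where
  toLinearEquiv := e.toLinearEquiv.prodCongr f.toLinearEquiv
  norm_map' p := by simp [Prod.norm_def]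

section Kronecker

open MeasureTheory UnitAddTorus

theorem ContinuousMap.integrable_of_compactSpace {X : Type*} [TopologicalSpace X]
    [CompactSpace X] [MeasurableSpace X] [OpensMeasurableSpace X] {ν : Measure X}
    [IsFiniteMeasure ν] (F : C(X, ℂ)) : Integrable F ν :=
  F.continuous.integrable_of_hasCompactSupport (HasCompactSupport.of_compactSpace _)

theorem ContinuousMap.continuous_integral {X : Type*} [TopologicalSpace X] [CompactSpace X]
    [MeasurableSpace X] [OpensMeasurableSpace X] {ν : Measure X} [IsFiniteMeasure ν] :
    Continuous fun F : C(X, ℂ) => ∫ x, F x ∂ν := by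
  refine (LipschitzWith.of_dist_le_mul (K := (ν Set.univ).toNNReal) fun F G => ?_).continuous
  rw [dist_eq_norm, dist_eq_norm,
    ← integral_sub F.integrable_of_compactSpace G.integrable_of_compactSpace, mul_comm]
  exact norm_integral_le_of_norm_le_const (Eventually.of_forall (F - G).norm_coe_le_norm)

theorem UnitAddTorus.isProbabilityMeasure_volume {d : Type*} [Fintype d] :
    IsProbabilityMeasure (volume : Measure (UnitAddTorus d)) :=
  haveI : IsProbabilityMeasure (volume : Measure UnitAddCircle) := ⟨by simp⟩
  inferInstanceAs (IsProbabilityMeasure (Measure.pi fun _ : d => (volume : Measure UnitAddCircle)))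

attribute [local instance] UnitAddTorus.isProbabilityMeasure_volume

variable {d : Type*} [Fintype d]

theorem UnitAddTorus.mFourier_add_apply (m : d → ℤ) (x y : UnitAddTorus d) :
    mFourier m (x + y) = mFourier m x * mFourier m y := by
  simp [mFourier, fourier_apply, smul_add, AddCircle.toCircle_add, Finset.prod_mul_distrib]

theorem UnitAddTorus.mFourier_nsmul (m : d → ℤ) (n : ℕ) (x : UnitAddTorus d) :
    mFourier m (n • x) = mFourier m x ^ n := by
  induction n with
  | zero => simp [mFourier]
  | succ n ih => rw [succ_nsmul, mFourier_add_apply, ih, pow_succ]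

theorem UnitAddTorus.norm_mFourier_apply (m : d → ℤ) (x : UnitAddTorus d) :
    ‖mFourier m x‖ = 1 := by
  simp only [mFourier, ContinuousMap.coe_mk, fourier_apply, norm_prod, Circle.norm_coe,
    Finset.prod_const_one]

theorem tendsto_inv_mul_geom_sum {z : ℂ} (hz : ‖z‖ = 1) (h1 : z ≠ 1) :
    Tendsto (fun N : ℕ => (N : ℂ)⁻¹ * ∑ n ∈ Finset.range N, z ^ n) atTop (𝓝 0) := by
  have hinv : Tendsto (fun N : ℕ => (N : ℝ)⁻¹ * (2 / ‖z - 1‖)) atTop (𝓝 0) := by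
    simpa using (tendsto_inv_atTop_nhds_zero_nat (𝕜 := ℝ)).mul_const (2 / ‖z - 1‖)
  refine squeeze_zero_norm (fun N => ?_) hinv
  rw [geom_sum_eq h1, norm_mul, norm_inv, RCLike.norm_natCast, norm_div]
  gcongr
  refine (norm_sub_le _ _).trans_eq ?_
  rw [norm_pow, hz, norm_one]
  norm_num

/-- Weyl equidistribution on finite-dimensional tori. -/
theorem UnitAddTorus.tendsto_birkhoffAverage {θ : UnitAddTorus d}
    (hθ : ∀ m : d → ℤ, mFourier m θ = 1 → m = 0) (F : C(UnitAddTorus d, ℂ)) :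
    Tendsto (fun N : ℕ => (N : ℂ)⁻¹ * ∑ n ∈ Finset.range N, F (n • θ)) atTop (𝓝 (∫ x, F x)) := by
  let K : C(UnitAddTorus d, ℂ) → C(UnitAddTorus d, ℂ) :=
    fun G => G.comp (ContinuousMap.addRight θ)
  have hiter : ∀ (n : ℕ) (G : C(UnitAddTorus d, ℂ)), K^[n] G 0 = G (n • θ) := by
    have aux : ∀ (n : ℕ) (G : C(UnitAddTorus d, ℂ)) x, K^[n] G x = G (x + n • θ) := by
      intro n
      induction n with
      | zero => simp
      | succ n ih =>
        intro G x
        rw [Function.iterate_succ_apply, ih, succ_nsmul, ← add_assoc]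
        rfl
    intro n G
    rw [aux, zero_add]
  have hK : LipschitzWith 1 K := LipschitzWith.mk_one fun G H =>
    (ContinuousMap.dist_le dist_nonneg).2 fun x =>
      ContinuousMap.dist_apply_le_dist (f := G) (g := H) (x + θ)
  have hint : Continuous fun G : C(UnitAddTorus d, ℂ) => ∫ x, G x :=
    ContinuousMap.continuous_integral
  have heval : LipschitzWith 1 fun G : C(UnitAddTorus d, ℂ) => G 0 :=
    LipschitzWith.mk_one fun G H => ContinuousMap.dist_apply_le_dist _
  have hclosed := isClosed_setOfPred_tendsto_birkhoffAverage ℂ hK heval.uniformContinuous hint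
  have hmem : ∀ G ∈ Submodule.span ℂ (Set.range (mFourier (d := d))),
      Tendsto (fun N : ℕ => (N : ℂ)⁻¹ * ∑ n ∈ Finset.range N, G (n • θ)) atTop (𝓝 (∫ x, G x)) := by
    intro G hG
    induction hG using Submodule.span_induction with
    | mem G hG =>
      obtain ⟨m, rfl⟩ := hG
      simp only [mFourier_nsmul]
      by_cases hm : m = 0
      · subst hm
        refine tendsto_const_nhds.congr' ?_
        filter_upwards [eventually_ne_atTop 0] with N hN
        simp [mFourier_zero, hN]
      · have hne : mFourier m θ ≠ 1 := fun h => hm (hθ m h)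
        have hzero : ∫ x, mFourier m x = 0 := by
          have h := integral_add_right_eq_self (μ := volume) (fun x => mFourier m x) θ
          simp only [mFourier_add_apply, integral_mul_const] at h
          have : (∫ x, mFourier m x) * (mFourier m θ - 1) = 0 := by rw [mul_sub, h]; ring
          exact (mul_eq_zero.1 this).resolve_right (sub_ne_zero.2 hne)
        rw [hzero]
        exact tendsto_inv_mul_geom_sum (norm_mFourier_apply m θ) hne
    | zero => simp
    | add G H _ _ hG hH =>
      simp only [ContinuousMap.add_apply, Finset.sum_add_distrib, mul_add,
        integral_add G.integrable_of_compactSpace H.integrable_of_compactSpace]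
      exact hG.add hH
    | smul a G _ hG =>
      simp only [ContinuousMap.smul_apply, smul_eq_mul, ← Finset.mul_sum, integral_const_mul,
        mul_left_comm _ a]
      exact hG.const_mul a
  have hsub : (Submodule.span ℂ (Set.range (mFourier (d := d)))).topologicalClosure.carrier ⊆ _ :=
    closure_minimal (fun G hG => ?_) hclosed
  · rw [span_mFourier_closure_eq_top] at hsub
    have hF := hsub (Set.mem_univ F)
    simpa [birkhoffAverage, birkhoffSum, hiter] using hF
  · simpa [birkhoffAverage, birkhoffSum, hiter] using hmem G hG

theorem UnitAddTorus.frequently_nsmul_mem {θ : UnitAddTorus d}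
    (hθ : ∀ m : d → ℤ, mFourier m θ = 1 → m = 0) {U : Set (UnitAddTorus d)} (hU : IsOpen U)
    (hne : U.Nonempty) : ∃ᶠ n : ℕ in atTop, n • θ ∈ U := by
  obtain ⟨x, hx⟩ := hne
  obtain ⟨f, hf0, hf1, hf⟩ := exists_continuous_zero_one_of_isClosed hU.isClosed_compl
    (isClosed_singleton (x := x)) (Set.disjoint_singleton_right.2 fun h => h hx)
  have hpos : 0 < ∫ y, f y := f.continuous.integral_pos_of_hasCompactSupport_nonneg_nonzero
    (HasCompactSupport.of_compactSpace _) (fun y => (hf y).1) (x := x) (by simp [hf1 rfl])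
  intro hev
  obtain ⟨N₀, hN₀⟩ := eventually_atTop.1 hev
  have hzero : ∀ n ≥ N₀, f (n • θ) = 0 := fun n hn => hf0 (hN₀ n hn)
  have hlim := tendsto_birkhoffAverage hθ
    (ContinuousMap.comp ⟨Complex.ofReal, Complex.continuous_ofReal⟩ f)
  have hlim0 : Tendsto (fun N : ℕ => (N : ℂ)⁻¹ * ∑ n ∈ Finset.range N, (f (n • θ) : ℂ)) atTop
      (𝓝 0) := by
    have h0 : Tendsto (fun N : ℕ => (N : ℂ)⁻¹ * ∑ n ∈ Finset.range N₀, (f (n • θ) : ℂ)) atTop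
        (𝓝 0) := by
      simpa using (tendsto_inv_atTop_nhds_zero_nat (𝕜 := ℂ)).mul_const
        (∑ n ∈ Finset.range N₀, (f (n • θ) : ℂ))
    refine h0.congr' ?_
    filter_upwards [eventually_ge_atTop N₀] with N hN
    congr 1
    refine Finset.sum_subset (Finset.range_subset_range.2 hN) fun n _ hn => ?_
    rw [hzero n (not_lt.1 fun h => hn (Finset.mem_range.2 h)), Complex.ofReal_zero]
  have hlim' := tendsto_nhds_unique hlim hlim0
  change ∫ y, (f y : ℂ) = 0 at hlim'
  rw [integral_complex_ofReal, Complex.ofReal_eq_zero] at hlim'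
  exact hpos.ne' hlim'

end Kronecker

section ExistsDense

open UnitAddTorus

theorem UnitAddTorus.mFourier_coe_eq_one_iff {d : Type*} [Fintype d] (θ : d → ℝ) (m : d → ℤ) :
    mFourier m (fun j => (θ j : UnitAddCircle)) = 1 ↔ ∃ k : ℤ, ∑ j, (m j : ℝ) * θ j = k := by
  have h : mFourier m (fun j => (θ j : UnitAddCircle)) =
      Complex.exp ((∑ j, (m j : ℝ) * θ j : ℝ) * (2 * Real.pi * Complex.I)) := by
    simp only [mFourier, ContinuousMap.coe_mk, fourier_coe_apply]
    rw [← Complex.exp_sum]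
    congr 1
    push_cast
    rw [Finset.sum_mul]
    exact Finset.sum_congr rfl fun j _ => by ring
  rw [h, Complex.exp_eq_one_iff]
  refine exists_congr fun k => ?_
  rw [mul_left_inj' Complex.two_pi_I_ne_zero]
  exact_mod_cast Iff.rfl

theorem exists_linearIndependent_option {J : Type} (hJ : Cardinal.mk J ≤ Cardinal.continuum) :
    ∃ v : Option J → ℝ, LinearIndependent ℚ v ∧ v none = 1 := by
  let b := Module.Basis.ofVectorSpace ℚ ℝ
  have hcard : Cardinal.mk (Option J) ≤
      Cardinal.mk (Module.Basis.ofVectorSpaceIndex ℚ ℝ) := by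
    rw [b.mk_eq_rank'', Real.rank_rat_real, Cardinal.mk_option]
    exact Cardinal.add_le_of_le Cardinal.aleph0_le_continuum hJ
      (Cardinal.one_le_aleph0.trans Cardinal.aleph0_le_continuum)
  obtain ⟨e⟩ := hcard
  have hne : b (e none) ≠ 0 := b.ne_zero _
  refine ⟨fun j => (b (e none))⁻¹ * b (e j), ?_, inv_mul_cancel₀ hne⟩
  exact (b.linearIndependent.comp e e.injective).map'
    (LinearMap.mulLeft ℚ (b (e none))⁻¹)
    (LinearMap.ker_eq_bot.2 (mul_right_injective₀ (inv_ne_zero hne)))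

/-- A torus of dimension at most the continuum has a point whose forward orbit visits every
nonempty open set infinitely often. -/
theorem exists_frequently_pow_mem {J : Type} (hJ : Cardinal.mk J ≤ Cardinal.continuum) :
    ∃ ρ : J → Circle, ∀ U : Set (J → Circle), IsOpen U → U.Nonempty →
      ∃ᶠ n : ℕ in atTop, ρ ^ n ∈ U := by
  obtain ⟨v, hv, hv1⟩ := exists_linearIndependent_option hJ
  refine ⟨fun j => AddCircle.toCircle (v (some j) : UnitAddCircle), fun U hU ⟨x, hx⟩ => ?_⟩
  obtain ⟨s, u, hu, hsu⟩ := isOpen_pi_iff.1 hU x hx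
  let θ : UnitAddTorus s := fun j => (v (some j) : UnitAddCircle)
  have hθ : ∀ m : s → ℤ, mFourier m θ = 1 → m = 0 := by
    intro m hm
    obtain ⟨k, hk⟩ := (mFourier_coe_eq_one_iff (fun j : s => v (some j)) m).1 hm
    let w : Option s → ℚ := fun o => o.elim (-k) fun j => m j
    have hinj : Function.Injective (Option.map (Subtype.val : s → J)) :=
      Option.map_injective Subtype.val_injective
    have hw := Fintype.linearIndependent_iff.1 (hv.comp _ hinj) w <| by
      simp only [Fintype.sum_option, w, Function.comp_apply, Option.map_none, Option.map_some,
        Option.elim_none, Option.elim_some, hv1, Rat.smul_def]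
      push_cast
      rw [hk]
      ring
    funext j
    exact Int.cast_eq_zero.1 (hw (some j))
  let V : Set (UnitAddTorus s) := Set.univ.pi fun j => AddCircle.toCircle ⁻¹' u j
  have hV : IsOpen V := isOpen_set_pi Set.finite_univ fun j _ =>
    (hu j j.2).1.preimage AddCircle.continuous_toCircle
  have hVne : V.Nonempty := by
    refine ⟨fun j => (AddCircle.homeomorphCircle one_ne_zero).symm (x j), fun j _ => ?_⟩
    rw [Set.mem_preimage, ← AddCircle.homeomorphCircle_apply one_ne_zero,
      Homeomorph.apply_symm_apply]
    exact (hu j j.2).2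
  refine (frequently_nsmul_mem hθ hV hVne).mono fun n hn => hsu fun j hj => ?_
  have := hn ⟨j, hj⟩ (Set.mem_univ _)
  rwa [Set.mem_preimage, Pi.smul_apply, AddCircle.toCircle_nsmul] at this

theorem eq_of_tendsto_pow {J : Type} {ρ : J → Circle}
    (hρ : ∀ U : Set (J → Circle), IsOpen U → U.Nonempty → ∃ᶠ n : ℕ in atTop, ρ ^ n ∈ U)
    {Φ : (J → Circle) → ℂ} (hΦ : Continuous Φ) {L : ℂ}
    (hL : Tendsto (fun n : ℕ => Φ (ρ ^ n)) atTop (𝓝 L)) (x : J → Circle) : Φ x = L := by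
  by_contra hne
  obtain ⟨A, B, hA, hB, hxA, hLB, hAB⟩ := t2_separation hne
  obtain ⟨n, hn, hn'⟩ := ((hρ _ (hA.preimage hΦ) ⟨x, hxA⟩).and_eventually
    (hL (hB.mem_nhds hLB))).exists
  exact Set.disjoint_left.1 hAB hn hn'

end ExistsDense

/-- Multiplication by a unimodular constant. -/
noncomputable def Circle.smulLinearIsometryEquiv (b : Circle) (E : Type*) [NormedAddCommGroup E]
    [NormedSpace ℂ E] : E ≃ₗᵢ[ℂ] E where
  toLinearEquiv := LinearEquiv.smulOfNeZero ℂ E (b : ℂ) b.coe_ne_zero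
  norm_map' x := (norm_smul (b : ℂ) x).trans (by rw [b.norm_coe, one_mul])

/-- The isometry `f ↦ w * (f ∘ φ)` of `C(Y, ℂ)`, for a homeomorphism `φ` and a unimodular
weight `w`. -/
noncomputable def ContinuousMap.weightedComp {Y : Type*} [TopologicalSpace Y] [CompactSpace Y]
    (φ : Y ≃ₜ Y) (w : C(Y, Circle)) : C(Y, ℂ) ≃ₗᵢ[ℂ] C(Y, ℂ) where
  toFun f := ⟨fun y => w y * f (φ y), by fun_prop⟩
  invFun f := ⟨fun y => ((w (φ.symm y))⁻¹ : Circle) * f (φ.symm y), by fun_prop⟩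
  left_inv f := by ext y; simp
  right_inv f := by ext y; simp
  map_add' f g := by ext y; simp [mul_add]
  map_smul' a f := by ext y; simp [mul_left_comm]
  norm_map' f := by
    refine le_antisymm ((ContinuousMap.norm_le _ (norm_nonneg _)).2 fun y => ?_)
      ((ContinuousMap.norm_le _ (norm_nonneg _)).2 fun y => ?_)
    · simpa [Circle.norm_coe] using f.norm_coe_le_norm (φ y)
    · have h := ContinuousMap.norm_coe_le_norm
        (⟨fun y => w y * f (φ y), by fun_prop⟩ : C(Y, ℂ)) (φ.symm y)
      rwa [ContinuousMap.coe_mk, norm_mul, Circle.norm_coe, one_mul, φ.apply_symm_apply] at h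

section TorusSum

variable {n : ℕ} {ι : Fin n → Type}

/-- On the sum of the tori, the isometry translating by `ρ i` and multiplying by `a i` on the
`i`-th torus. -/
noncomputable def torusSumRotation (a : Fin n → Circle) (ρ : ∀ i, ι i → Circle) :
    C(Σ i, (ι i → Circle), ℂ) ≃ₗᵢ[ℂ] C(Σ i, (ι i → Circle), ℂ) :=
  ContinuousMap.weightedComp
    { toEquiv := Equiv.sigmaCongrRight fun i => Equiv.mulRight (ρ i)
      continuous_toFun := continuous_sigma_iff.2 fun i =>
        continuous_sigmaMk.comp (continuous_mul_const (ρ i))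
      continuous_invFun := continuous_sigma_iff.2 fun i =>
        continuous_sigmaMk.comp (continuous_mul_const (ρ i)⁻¹) }
    ⟨fun y => a y.1, continuous_sigma_iff.2 fun i => continuous_const (y := a i)⟩

theorem torusSumRotation_apply (a : Fin n → Circle) (ρ : ∀ i, ι i → Circle)
    (f : C(Σ i, (ι i → Circle), ℂ)) (i : Fin n) (x : ι i → Circle) :
    torusSumRotation a ρ f ⟨i, x⟩ = a i * f ⟨i, x * ρ i⟩ := rfl

theorem torusSumRotation_iterate (a : Fin n → Circle) (ρ : ∀ i, ι i → Circle)
    (f : C(Σ i, (ι i → Circle), ℂ)) (m : ℕ) (i : Fin n) (x : ι i → Circle) :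
    (torusSumRotation a ρ)^[m] f ⟨i, x⟩ = ((a i ^ m : Circle) : ℂ) * f ⟨i, x * ρ i ^ m⟩ := by
  induction m generalizing x with
  | zero => simp
  | succ m ih =>
    rw [Function.iterate_succ_apply', torusSumRotation_apply, ih, ← mul_assoc, pow_succ' (a i),
      pow_succ' (ρ i), mul_assoc x, Circle.coe_mul]

end TorusSum

section Linfty

open MeasureTheory AddCircle

variable {T : ℝ} [hT : Fact (0 < T)]

theorem AddCircle.ae_haarAddCircle_of_ae_volume {p : AddCircle T → Prop}
    (h : ∀ᵐ x, p x) : ∀ᵐ x ∂(haarAddCircle : Measure (AddCircle T)), p x := by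
  rw [volume_eq_smul_haarAddCircle] at h
  exact (Measure.ae_ennreal_smul_measure_iff (by simp [hT.out])).1 h

theorem fourierCoeff_comp_add_right (f : AddCircle T → ℂ) (α : AddCircle T) (k : ℤ) :
    fourierCoeff (fun x => f (x + α)) k = (toCircle α : ℂ) ^ k * fourierCoeff f k := by
  unfold fourierCoeff
  rw [← integral_add_right_eq_self (μ := haarAddCircle) (fun t => fourier (-k) t • f (t + α)) (-α),
    ← integral_const_mul]
  refine integral_congr_ae (Eventually.of_forall fun t => ?_)
  simp only [fourier_apply, neg_add_cancel_right, smul_eq_mul, smul_add, toCircle_add,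
    Circle.coe_mul, smul_neg, neg_smul, neg_neg, toCircle_zsmul, Circle.coe_zpow]
  ring

/-- Rotation of `L^∞` of the circle. -/
noncomputable def LinftyRotation (α : AddCircle T) :
    Lp ℂ ⊤ (volume : Measure (AddCircle T)) ≃ₗᵢ[ℂ] Lp ℂ ⊤ (volume : Measure (AddCircle T)) :=
  LinearIsometryEquiv.ofSurjective
    (Lp.compMeasurePreservingₗᵢ ℂ (· + α) (measurePreserving_add_right volume α)) fun g => by
      refine ⟨Lp.compMeasurePreserving (· + -α) (measurePreserving_add_right volume (-α)) g, ?_⟩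
      change Lp.compMeasurePreserving _ _ (Lp.compMeasurePreserving _ _ g) = g
      rw [← Lp.compMeasurePreserving_comp_apply]
      convert Lp.compMeasurePreserving_id_apply g using 3
      ext x
      simp

theorem fourierCoeff_LinftyRotation (α : AddCircle T)
    (g : Lp ℂ ⊤ (volume : Measure (AddCircle T))) (k : ℤ) :
    fourierCoeff (LinftyRotation α g) k = (toCircle α : ℂ) ^ k * fourierCoeff g k := by
  rw [← fourierCoeff_comp_add_right]
  exact congr_fun (fourierCoeff_congr_ae (ae_haarAddCircle_of_ae_volume
    (Lp.coeFn_compMeasurePreserving g (measurePreserving_add_right volume α)))) k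

/-- The `k`-th Fourier coefficient as a functional on `L^∞` of the circle. -/
noncomputable def fourierCoeffLinfty (k : ℤ) :
    Lp ℂ ⊤ (volume : Measure (AddCircle T)) →L[ℂ] ℂ :=
  LinearMap.mkContinuous
    { toFun := fun g => fourierCoeff g k
      map_add' := fun f g => by
        have hi : ∀ f : Lp ℂ ⊤ (volume : Measure (AddCircle T)),
            Integrable f (haarAddCircle : Measure (AddCircle T)) := fun f =>
          memLp_one_iff_integrable.1 ((Lp.memLp f).haarAddCircle.mono_exponent le_top)
        rw [fourierCoeff_congr_ae (ae_haarAddCircle_of_ae_volume (Lp.coeFn_add f g)),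
          fourierCoeff.add (hi f) (hi g)]
        rfl
      map_smul' := fun a g => by
        rw [fourierCoeff_congr_ae (ae_haarAddCircle_of_ae_volume (Lp.coeFn_smul a g)),
          fourierCoeff.const_smul]
        rfl } 1 fun g => by
    have hle : ∀ᵐ x, ‖g x‖ ≤ ‖g‖ := by
      filter_upwards [enorm_ae_le_eLpNormEssSup g volume] with x hx
      rwa [← eLpNorm_exponent_top, ← Lp.enorm_def, enorm_le_iff_norm_le] at hx
    refine (norm_integral_le_of_norm_le_const (C := ‖g‖) ?_).trans (by simp)
    filter_upwards [ae_haarAddCircle_of_ae_volume hle] with x hx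
    simpa [norm_smul, Circle.norm_coe] using hx

theorem norm_fourierCoeffLinfty_le (k : ℤ) : ‖fourierCoeffLinfty (T := T) k‖ ≤ 1 :=
  LinearMap.mkContinuous_norm_le _ zero_le_one _

theorem eq_zero_of_fourierCoeff_eq_zero (g : Lp ℂ ⊤ (volume : Measure (AddCircle T)))
    (h : ∀ k, fourierCoeff g k = 0) : g = 0 := by
  have hmem : MemLp g 2 (haarAddCircle : Measure (AddCircle T)) :=
    (Lp.memLp g).haarAddCircle.mono_exponent le_top
  have hrepr : fourierBasis.repr hmem.toLp = 0 := by
    ext k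
    rw [fourierBasis_repr, fourierCoeff_congr_ae hmem.coeFn_toLp, h]
    rfl
  have hzero : hmem.toLp = 0 := fourierBasis.repr.map_eq_zero_iff.1 hrepr
  have hae := (MemLp.toLp_eq_toLp_iff hmem MemLp.zero).1 (hzero.trans (MemLp.toLp_zero _).symm)
  refine (Lp.eq_zero_iff_ae_eq_zero).2 ?_
  change g =ᵐ[ENNReal.ofReal T • haarAddCircle] 0
  exact Measure.ae_smul_measure hae _

/-- A trigonometric series with summable coefficients that vanishes identically is trivial. -/
theorem eq_zero_of_tsum_mul_zpow_eq_zero {a : ℤ → ℂ} (ha : Summable a)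
    (h : ∀ z : Circle, ∑' k, a k * (z : ℂ) ^ k = 0) (k : ℤ) : a k = 0 := by
  have hsum : Summable fun k => a k • (fourier k : C(UnitAddCircle, ℂ)) := by
    refine .of_norm ?_
    simpa only [norm_smul, fourier_norm, mul_one] using ha.norm
  have hzero : HasSum (fun k => a k • (fourier k : C(UnitAddCircle, ℂ))) 0 := by
    convert hsum.hasSum
    ext x
    have := (ContinuousMap.evalCLM ℂ x).map_tsum hsum
    simp only [ContinuousMap.evalCLM_apply, ContinuousMap.smul_apply, fourier_apply, toCircle_zsmul,
      Circle.coe_zpow, smul_eq_mul] at this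
    rw [this, h, ContinuousMap.zero_apply]
  let Λ : C(UnitAddCircle, ℂ) →L[ℂ] ℂ :=
    (innerSL ℂ (fourierLp 2 k)) ∘L ContinuousMap.toLp (E := ℂ) 2 haarAddCircle ℂ
  have hΛ : ∀ j, Λ (a j • fourier j) = if j = k then a k else 0 := by
    intro j
    have := orthonormal_iff_ite.1 (orthonormal_fourier (T := 1)) k j
    rw [map_smul]
    change a j • inner ℂ (fourierLp 2 k) (fourierLp (T := 1) 2 j) = _
    rw [this]
    by_cases hjk : j = k
    · simp [hjk]
    · simp [hjk, Ne.symm hjk]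
  have h1 := hzero.mapL Λ
  simp only [hΛ, map_zero] at h1
  exact (hasSum_ite_eq k (a k)).unique h1

/-- The functional `∑ c k * ĝ(k)` on `L^∞` of the circle detects `g` along the orbits of
rotations: its values form a continuous function of the rotation, which is nonzero if `g` is. -/
theorem exists_functional_Linfty :
    ∃ (μ : Lp ℂ ⊤ (volume : Measure (AddCircle T)) →L[ℂ] ℂ)
      (G : Lp ℂ ⊤ (volume : Measure (AddCircle T)) → C(Circle, ℂ)),
      (∀ g α, ∀ m : ℕ, μ ((LinftyRotation α)^[m] g) = G g (toCircle α ^ m)) ∧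
      ∀ g, G g = 0 → g = 0 := by
  obtain ⟨c, hpos, _, hc, -⟩ := posSumOfEncodable one_pos ℤ
  have hcoeff : ∀ (g : Lp ℂ ⊤ (volume : Measure (AddCircle T))) (k : ℤ),
      ‖(c k : ℂ) * fourierCoeff g k‖ ≤ c k * ‖g‖ := fun g k => by
    rw [norm_mul, Complex.norm_real, Real.norm_of_nonneg (hpos k).le]
    exact mul_le_mul_of_nonneg_left
      (((fourierCoeffLinfty k).le_of_opNorm_le (norm_fourierCoeffLinfty_le k) g).trans_eq
        (one_mul _)) (hpos k).le
  have hsummable : Summable fun k => (c k : ℂ) • fourierCoeffLinfty (T := T) k := by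
    refine .of_norm_bounded hc.summable fun k => ?_
    rw [norm_smul, Complex.norm_real, Real.norm_of_nonneg (hpos k).le]
    exact mul_le_of_le_one_right (hpos k).le (norm_fourierCoeffLinfty_le k)
  refine ⟨∑' k, (c k : ℂ) • fourierCoeffLinfty k,
    fun g => ⟨fun z => ∑' k, (c k : ℂ) * fourierCoeff g k * (z : ℂ) ^ k, ?_⟩, ?_, ?_⟩
  · refine continuous_tsum (fun k => ?_) (hc.summable.mul_right ‖g‖) fun k z => ?_
    · simp only [← Circle.coe_zpow]
      exact continuous_const.mul (continuous_subtype_val.comp (continuous_zpow k))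
    · rw [norm_mul, norm_zpow, Circle.norm_coe, one_zpow, mul_one]
      exact hcoeff g k
  · intro g α m
    have hiter : ∀ k, fourierCoeff ((LinftyRotation α)^[m] g) k =
        fourierCoeff g k * ((toCircle α ^ m : Circle) : ℂ) ^ k := by
      intro k
      induction m with
      | zero => simp
      | succ m ih =>
        rw [Function.iterate_succ_apply', fourierCoeff_LinftyRotation, ih, pow_succ,
          Circle.coe_mul, mul_zpow]
        ring
    have := (ContinuousLinearMap.apply ℂ ℂ ((LinftyRotation α)^[m] g)).map_tsum hsummable
    simp only [ContinuousLinearMap.apply_apply] at this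
    rw [this]
    refine tsum_congr fun k => ?_
    change (c k : ℂ) * fourierCoeff ((LinftyRotation α)^[m] g) k = _
    rw [hiter, mul_assoc]
  · intro g hg
    refine eq_zero_of_fourierCoeff_eq_zero g fun k => ?_
    have := eq_zero_of_tsum_mul_zpow_eq_zero
      (.of_norm_bounded (hc.summable.mul_right ‖g‖) (hcoeff g)) (fun z => DFunLike.congr_fun hg z) k
    exact (mul_eq_zero.1 this).resolve_left (Complex.ofReal_ne_zero.2 (hpos k).ne')

end Linfty

section Assembly

open MeasureTheory AddCircle

theorem LinftyRotation_trans_smul_iterate {T : ℝ} [Fact (0 < T)] (α : AddCircle T) (b : Circle)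
    (g : Lp ℂ ⊤ (volume : Measure (AddCircle T))) (m : ℕ) :
    ((LinftyRotation α).trans (Circle.smulLinearIsometryEquiv b _))^[m] g =
      ((b ^ m : Circle) : ℂ) • (LinftyRotation α)^[m] g := by
  induction m with
  | zero => simp
  | succ m ih =>
    rw [Function.iterate_succ_apply', ih, Function.iterate_succ_apply']
    change (b : ℂ) • LinftyRotation α (((b ^ m : Circle) : ℂ) • _) = _
    rw [map_smul, smul_smul, pow_succ', Circle.coe_mul]

theorem mk_bool_sum_sigma_option_le {n : ℕ} {ι : Fin n → Type}
    (hι : ∀ i, Cardinal.mk (ι i) ≤ Cardinal.continuum) :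
    Cardinal.mk (Bool ⊕ Σ i, Option (ι i)) ≤ Cardinal.continuum := by
  have h : ∀ i, Cardinal.mk (Option (ι i)) ≤ Cardinal.continuum := fun i => by
    rw [Cardinal.mk_option]
    exact Cardinal.add_le_of_le Cardinal.aleph0_le_continuum (hι i)
      (Cardinal.one_le_aleph0.trans Cardinal.aleph0_le_continuum)
  rw [Cardinal.mk_sum, Cardinal.mk_sigma, Cardinal.lift_id, Cardinal.lift_id]
  refine Cardinal.add_le_of_le Cardinal.aleph0_le_continuum
    (Cardinal.mk_le_aleph0.trans Cardinal.aleph0_le_continuum)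
    ((Cardinal.sum_le_sum _ _ h).trans ?_)
  rw [Cardinal.sum_const']
  exact Cardinal.mul_le_of_le Cardinal.aleph0_le_continuum
    (Cardinal.mk_le_aleph0.trans Cardinal.aleph0_le_continuum) le_rfl

/-- An isometry of `L^∞(𝕋) × C(𝕋^{ι 1} ⊕ ⋯ ⊕ 𝕋^{ι n})` and a functional whose values along the
orbit of a nonzero element do not converge. -/
theorem exists_rotation_functional {T : ℝ} [Fact (0 < T)] {n : ℕ} {ι : Fin n → Type}
    (hι : ∀ i, Cardinal.mk (ι i) ≤ Cardinal.continuum) :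
    ∃ (R : (Lp ℂ ⊤ (volume : Measure (AddCircle T)) × C(Σ i, (ι i → Circle), ℂ)) ≃ₗᵢ[ℂ]
        (Lp ℂ ⊤ (volume : Measure (AddCircle T)) × C(Σ i, (ι i → Circle), ℂ)))
      (μ : Lp ℂ ⊤ (volume : Measure (AddCircle T)) × C(Σ i, (ι i → Circle), ℂ) →L[ℂ] ℂ),
      ∀ g L, Tendsto (fun m : ℕ => μ (R^[m + 1] g)) atTop (𝓝 L) → g = 0 := by
  obtain ⟨ρ, hρ⟩ := exists_frequently_pow_mem (mk_bool_sum_sigma_option_le hι)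
  obtain ⟨μ₀, G, hG, hG0⟩ := exists_functional_Linfty (T := T)
  obtain ⟨α, hα⟩ : ∃ α : AddCircle T, toCircle α = ρ (.inl true) :=
    by simpa only [homeomorphCircle_apply] using
      (homeomorphCircle (Fact.out : 0 < T).ne').surjective (ρ (.inl true))
  set RL := (LinftyRotation α).trans (Circle.smulLinearIsometryEquiv (ρ (.inl false)) _) with hRL
  set RT := torusSumRotation (fun i => ρ (.inr ⟨i, none⟩))
    (fun i (j : ι i) => ρ (.inr ⟨i, some j⟩)) with hRT
  refine ⟨RL.prodMap RT, μ₀ ∘L .fst ℂ _ _ +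
    (∑ i, ContinuousMap.evalCLM ℂ ⟨i, 1⟩) ∘L .snd ℂ _ _, ?_⟩
  rintro ⟨g, f⟩ L hL
  set Φ : (Bool ⊕ (Σ i, Option (ι i)) → Circle) → ℂ := fun z =>
    z (.inl false) * G g (z (.inl true)) +
      ∑ i, (z (.inr ⟨i, none⟩) : ℂ) * f ⟨i, fun j => z (.inr ⟨i, some j⟩)⟩ with hΦdef
  have hΦ : Continuous Φ := by
    have hcoord : ∀ k, Continuous fun z : Bool ⊕ (Σ i, Option (ι i)) → Circle => (z k : ℂ) :=
      fun k => continuous_subtype_val.comp (continuous_apply k)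
    exact ((hcoord _).mul ((G g).continuous.comp (continuous_apply _))).add <|
      continuous_finsetSum _ fun i _ => (hcoord _).mul <| f.continuous.comp <|
        continuous_sigmaMk.comp <| continuous_pi fun j => continuous_apply _
  have horbit : ∀ m : ℕ, (μ₀ ∘L .fst ℂ _ _ + (∑ i, ContinuousMap.evalCLM ℂ ⟨i, 1⟩) ∘L .snd ℂ _ _ :
      Lp ℂ ⊤ (volume : Measure (AddCircle T)) × C(Σ i, (ι i → Circle), ℂ) →L[ℂ] ℂ)
      ((RL.prodMap RT)^[m] (g, f)) = Φ (ρ ^ m) := by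
    intro m
    have hiter : (RL.prodMap RT)^[m] (g, f) = (RL^[m] g, RT^[m] f) :=
      congr_fun (Prod.map_iterate RL RT m) (g, f)
    rw [hiter]
    simp only [add_apply, ContinuousLinearMap.comp_apply,
      ContinuousLinearMap.coe_fst', ContinuousLinearMap.coe_snd', sum_apply,
      ContinuousMap.evalCLM_apply, hRL, hRT, LinftyRotation_trans_smul_iterate,
      torusSumRotation_iterate, map_smul, hG, hα, one_mul]
    rfl
  have hconst : ∀ z, Φ z = L := eq_of_tendsto_pow hρ hΦ <|
    (tendsto_add_atTop_iff_nat 1).1 (hL.congr fun m => horbit (m + 1))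
  have hG_zero : G g = 0 := by
    ext w
    have h1 := hconst (Sum.elim (fun b => cond b w 1) 1)
    have h2 := hconst (Sum.elim (fun b => cond b w (-1)) 1)
    have := h1.trans h2.symm
    simp only [hΦdef, Sum.elim_inl, Sum.elim_inr, cond_true, cond_false, Circle.coe_one,
      Circle.coe_neg, add_left_inj, one_mul, neg_mul] at this
    exact self_eq_neg.1 this
  have hf_zero : f = 0 := by
    ext ⟨i, x⟩
    have hinj : Function.Injective fun j : ι i =>
        (.inr ⟨i, some j⟩ : Bool ⊕ Σ i, Option (ι i)) := fun j k hjk => by simpa using hjk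
    classical
    set z := Function.extend (fun j : ι i => (.inr ⟨i, some j⟩ : Bool ⊕ Σ i, Option (ι i))) x 1
      with hz
    have hzx : (fun j => z (.inr ⟨i, some j⟩)) = x := funext fun j => hinj.extend_apply x 1 j
    have hflip := (hconst z).trans
      (hconst (Function.update z (.inr ⟨i, none⟩) (-z (.inr ⟨i, none⟩)))).symm
    simp only [hΦdef] at hflip
    rw [← sub_eq_zero, add_sub_add_comm, ← Finset.sum_sub_distrib,
      Finset.sum_eq_single i (fun k _ hk => by simp [hk]) (by simp)] at hflip
    simpa [hzx, ← two_mul] using hflip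
  rw [hG0 g hG_zero, hf_zero]
  rfl

end Assembly

/-- For `n ≥ 1`, types `ι i` of cardinality at most `𝔠` and `M` with `C(M;ℂ) ≅ L^∞(𝕋)`
isometrically as complex Banach algebras, `C(M ⊕ 𝕋^{ι 1} ⊕ ⋯ ⊕ 𝕋^{ι n} ⊕ OnePoint ℕ, ℂ)`
admits an isometric shift. -/
theorem stmt8 (n : ℕ) (hn : 1 ≤ n) (ι : Fin n → Type)
    (hι : ∀ i, Cardinal.mk (ι i) ≤ Cardinal.continuum)
    (M : Type) [TopologicalSpace M] [CompactSpace M] [T2Space M]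
    (hM : IsCMIsoLinftyCircle M) :
    ∃ T : C(M ⊕ (Σ i : Fin n, (ι i → Circle)) ⊕ OnePoint ℕ, ℂ) →L[ℂ]
        C(M ⊕ (Σ i : Fin n, (ι i → Circle)) ⊕ OnePoint ℕ, ℂ),
      IsIsometricShift T := by
  obtain ⟨e, -⟩ := hM
  obtain ⟨R, μ, h⟩ := exists_rotation_functional (T := 2 * Real.pi) hι
  let e₁ := (ContinuousMap.sumLinearIsometryEquiv M ((Σ i, (ι i → Circle)) ⊕ OnePoint ℕ)).trans
    (e.prodMap (ContinuousMap.sumLinearIsometryEquiv (Σ i, (ι i → Circle)) (OnePoint ℕ)))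
  exact IsIsometricShift.exists_of_linearIsometryEquiv
    (e₁.trans (LinearIsometryEquiv.prodAssoc ℂ _ _ _).symm) (exists_isIsometricShift_prod R μ h)
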